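/- Let n, a, b, s, t be positive integers with a ≥ b + t - 1, t ≥ 2 and n ≥ a + b. Suppose F ⊆ C([n],a) and G ⊆ C([n],b) are initial (left-shifted) cross-intersecting families with τ(F) = s and τ(G) ≥ t. Then |F| + |G| ≤ Σ_{j=1}^{s} ( C(n-j, a-1) - Σ_{i=0}^{t-j-1} C(b+t-j-1, i) · C(n-b-t+1, a-i-1) ) + C(n-s, b-s) + C(b+t-1, b) - C(b+t-s-1, b-s), where an inner sum with upper limit below its lower limit is empty. -/

import Mathlib

open Finset

/-- Families `F` and `G` are cross-intersecting: every member of `F` meets every member of `G`. -/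
def crossInt (F G : Finset (Finset ℕ)) : Prop :=
  ∀ A ∈ F, ∀ B ∈ G, (A ∩ B).Nonempty

/-- The covering number of `F` (as a family of subsets of `[n] = Icc 1 n`) is at least `s`:
every `T ⊆ [n]` meeting all members of `F` has at least `s` elements. -/
def coverGE (n s : ℕ) (F : Finset (Finset ℕ)) : Prop :=
  ∀ T : Finset ℕ, T ⊆ Finset.Icc 1 n → (∀ A ∈ F, (T ∩ A).Nonempty) → s ≤ T.card

/-- The covering number of `F` equals `s`. -/
def coverEQ (n s : ℕ) (F : Finset (Finset ℕ)) : Prop :=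
  coverGE n s F ∧
    ∃ T : Finset ℕ, T ⊆ Finset.Icc 1 n ∧ (∀ A ∈ F, (T ∩ A).Nonempty) ∧ T.card = s

/-- `F` is initial (left-shifted): replacing an element `j` of a member by a smaller `i ∈ [n]`
not in it stays in the family. -/
def initialFam (n : ℕ) (F : Finset (Finset ℕ)) : Prop :=
  ∀ A ∈ F, ∀ i ∈ Finset.Icc 1 n, ∀ j ∈ A, i < j → i ∉ A → insert i (A.erase j) ∈ F

/-- `C(n,a) + ∑_{i=1}^t (-1)^i C(t,i) C(n-ib,a) + t`, the size of `M^t(n,a,b)`. -/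
def MtSize (n a b t : ℕ) : ℤ :=
  (n.choose a : ℤ) +
    (∑ i ∈ Finset.Icc 1 t, (-1 : ℤ) ^ i * (t.choose i : ℤ) * ((n - i * b).choose a : ℤ)) + t

/-- `C(n,a) - ∑_{i=0}^{t-1} C(b+t-1,i) C(n-b-t+1,a-i) + C(b+t-1,b)`, the size of `H^t(n,a,b)`. -/
def HtSize (n a b t : ℕ) : ℤ :=
  (n.choose a : ℤ) -
    (∑ i ∈ Finset.range t, ((b + t - 1).choose i : ℤ) * ((n - b - t + 1).choose (a - i) : ℤ)) +
    ((b + t - 1).choose b : ℤ)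

/-- `∑_{i=1}^s (C(n-i,a-1) + ∑_{j=1}^{t-1} (-1)^j C(t-1,j) C(n-jb-i,a-1)) + C(n-s,b-s) + t - 1`,
the size of `M_s^t(n,a,b)`. -/
def MstSize (n a b s t : ℕ) : ℤ :=
  (∑ i ∈ Finset.Icc 1 s, (((n - i).choose (a - 1) : ℤ) +
      ∑ j ∈ Finset.Icc 1 (t - 1),
        (-1 : ℤ) ^ j * ((t - 1).choose j : ℤ) * ((n - j * b - i).choose (a - 1) : ℤ))) +
    ((n - s).choose (b - s) : ℤ) + (t : ℤ) - 1

/-- `∑_{j=1}^s (C(n-j,a-1) - ∑_{i=0}^{t-j-1} C(b+t-j-1,i) C(n-b-t+1,a-i-1))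
+ C(n-s,b-s) + C(b+t-1,b) - C(b+t-s-1,b-s)`, the size of `H_s^t(n,a,b)`. -/
def HstSize (n a b s t : ℕ) : ℤ :=
  (∑ j ∈ Finset.Icc 1 s, (((n - j).choose (a - 1) : ℤ) -
      ∑ i ∈ Finset.range (t - j),
        ((b + t - j - 1).choose i : ℤ) * ((n - b - t + 1).choose (a - i - 1) : ℤ))) +
    ((n - s).choose (b - s) : ℤ) + ((b + t - 1).choose b : ℤ) -
    ((b + t - s - 1).choose (b - s) : ℤ)


lemma choose_mono_sym {N x y : ℕ} (hxy : x ≤ y) (h : x + y ≤ N) : N.choose x ≤ N.choose y := by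
  induction y, hxy using Nat.le_induction with
  | base => exact le_rfl
  | succ y hy ih =>
    rcases Nat.lt_or_ge y (N/2) with h1 | h1
    · exact (ih (by omega)).trans (Nat.choose_le_succ_of_lt_half_left h1)
    · have e : N.choose (N-(y+1)) = N.choose (y+1) := Nat.choose_symm (by omega)
      rw [← e]
      have : ∀ z, x ≤ z → z ≤ N/2 → N.choose x ≤ N.choose z := by
        intro z hz
        induction z, hz using Nat.le_induction with
        | base => intro _; exact le_rfl
        | succ z hz ih2 => 
          intro h3
          exact (ih2 (by omega)).trans (Nat.choose_le_succ_of_lt_half_left (by omega))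
      exact this _ (by omega) (by omega)

/-- The weighted rearrangement inequality. -/
lemma weighted (N e d : ℕ) (hN : e + d ≤ N) (α : ℕ → ℚ) (h0 : ∀ r, 0 ≤ α r)
    (he : α e = 0) (hd : d = 0 → α 0 = 0)
    (hm : ∀ r r', r ≤ r' → r' < e → r + r' + d = e → α r ≤ α r') :
    ∑ r ∈ range e, α r * ((N.choose (e - r) : ℚ) - N.choose (d + r)) ≤ 0 := by
  have hneg : ∀ r, r ≤ e → e ≤ d + 2 * r → α r * ((N.choose (e - r) : ℚ) - N.choose (d + r)) ≤ 0 := by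
    intro r hr h
    apply mul_nonpos_of_nonneg_of_nonpos (h0 r)
    have : N.choose (e-r) ≤ N.choose (d+r) := choose_mono_sym (by omega) (by omega)
    have : (N.choose (e-r) : ℚ) ≤ N.choose (d+r) := by exact_mod_cast this
    linarith
  rcases Nat.lt_or_ge e d with hed | hed
  · apply Finset.sum_nonpos
    intro r hr
    rw [mem_range] at hr
    exact hneg r (by omega) (by omega)
  have e1 : ∑ r ∈ range e, α r * ((N.choose (e - r) : ℚ) - N.choose (d + r))
      = ∑ r ∈ range (e+1), α r * ((N.choose (e - r) : ℚ) - N.choose (d + r)) := by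
    rw [sum_range_succ, he]; ring
  obtain ⟨K, rfl⟩ : ∃ K, e = K + d := ⟨e - d, by omega⟩
  rw [e1, show K + d + 1 = (K+1) + d by ring, sum_range_add]
  have h2 : ∑ x ∈ range d, α (K + 1 + x) * ((N.choose (K + d - (K + 1 + x)) : ℚ) - N.choose (d + (K + 1 + x))) ≤ 0 := by
    apply Finset.sum_nonpos
    intro r hr
    rw [mem_range] at hr
    exact hneg _ (by omega) (by omega)
  have h3 := Finset.sum_range_reflect (fun r => α r * ((N.choose (K + d - r) : ℚ) - N.choose (d + r))) (K+1)
  have h4 : ∑ r ∈ range (K+1), α r * ((N.choose (K + d - r) : ℚ) - N.choose (d + r)) +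
     ∑ r ∈ range (K+1), α (K+1-1-r) * ((N.choose (K + d - (K+1-1-r)) : ℚ) - N.choose (d + (K+1-1-r))) ≤ 0 := by
    rw [← sum_add_distrib]
    apply Finset.sum_nonpos
    intro r hr
    rw [mem_range] at hr
    obtain ⟨q, rfl⟩ : ∃ q, K = r + q := ⟨K - r, by omega⟩
    rw [show r + q + 1 - 1 - r = q by omega, show r + q + d - r = d + q by omega, show r + q + d - q = d + r by omega]
    have key : ∀ r q, r ≤ q → r + q + d ≤ N → α r ≤ α q → (α r - α q) * ((N.choose (d+q) : ℚ) - N.choose (d+r)) ≤ 0 ∨ N < 2 * d + r + q := by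
      intro r q h h' h''
      by_cases hh : N < 2 * d + r + q
      · exact Or.inr hh
      left
      apply mul_nonpos_of_nonpos_of_nonneg (by linarith)
      have : N.choose (d+r) ≤ N.choose (d+q) := choose_mono_sym (by omega) (by omega)
      have : (N.choose (d+r) : ℚ) ≤ N.choose (d+q) := by exact_mod_cast this
      linarith
    have mono : ∀ r' q', r' ≤ q' → r' + q' = r + q → α r' ≤ α q' := by
      intro r' q' h h'
      rcases Nat.lt_or_ge q' (r + q + d) with h5 | h5
      · exact hm r' q' h h5 (by omega)
      · have : d = 0 := by omega
        have : r' = 0 := by omega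
        subst this
        rw [hd (by omega)]; exact h0 _
    rcases le_total r q with hh | hh
    · rcases key r q hh (by omega) (mono r q hh rfl) with h | h
      · linarith
      · omega
    · rcases key q r hh (by omega) (mono q r hh (by omega)) with h | h
      · linarith
      · omega
  linarith

lemma lym_step (I J : Finset ℕ) (g : Finset ℕ → Finset ℕ → Prop) [∀ p : Finset ℕ × Finset ℕ, Decidable (g p.1 p.2)]
    (hshift : ∀ R X j k, R ⊆ I → X ⊆ J → g R X → j ∈ X → k ∈ I → k ∉ R → g (insert k R) (X.erase j))
    (r x : ℕ) :
    #{p ∈ powersetCard r I ×ˢ powersetCard (x+1) J | g p.1 p.2} * ((#I - r) * (x+1))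
     ≤ #{p ∈ powersetCard (r+1) I ×ˢ powersetCard x J | g p.1 p.2} * ((r+1) * (#J - x)) := by
  classical
  apply Finset.card_mul_le_card_mul (fun p q => p.1 ⊆ q.1 ∧ q.2 ⊆ p.2)
  · rintro ⟨R, X⟩ hp
    simp only [mem_filter, mem_product, mem_powersetCard] at hp
    obtain ⟨⟨⟨hR, hRc⟩, hX, hXc⟩, hg⟩ := hp
    have : (#I - r) * (x+1) = #((I \ R) ×ˢ X) := by
      rw [card_product, card_sdiff_of_subset hR, hRc, hXc]
    rw [this]
    apply Finset.card_le_card_of_injOn (fun q => (insert q.1 R, X.erase q.2))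
    · rintro ⟨k, j⟩ hq
      simp only [coe_product, Set.mem_prod, mem_coe, mem_sdiff] at hq
      obtain ⟨⟨hk, hkR⟩, hj⟩ := hq
      simp only [bipartiteAbove, mem_coe, mem_filter, mem_product, mem_powersetCard]
      refine ⟨⟨⟨⟨insert_subset hk hR, by rw [card_insert_of_notMem hkR, hRc]⟩, (erase_subset _ _).trans hX, by rw [card_erase_of_mem hj, hXc]; rfl⟩, hshift _ _ _ _ hR hX hg hj hk hkR⟩, subset_insert _ _, erase_subset _ _⟩
    · rintro ⟨k, j⟩ hq ⟨k', j'⟩ hq' h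
      simp only [coe_product, Set.mem_prod, mem_coe, mem_sdiff] at hq hq'
      simp only [Prod.mk.injEq] at h ⊢
      constructor
      · have : k ∈ insert k' R := h.1 ▸ mem_insert_self k R
        rcases mem_insert.1 this with h | h
        · exact h
        · exact absurd h hq.1.2
      · by_contra hne
        have : j ∈ X.erase j' := mem_erase.2 ⟨hne, hq.2⟩
        rw [← h.2] at this
        simp at this
  · rintro ⟨R, X⟩ hp
    simp only [mem_filter, mem_product, mem_powersetCard] at hp
    obtain ⟨⟨⟨hR, hRc⟩, hX, hXc⟩, hg⟩ := hp
    have : (r+1) * (#J - x) = #(R ×ˢ (J \ X)) := by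
      rw [card_product, card_sdiff_of_subset hX, hRc, hXc]
    rw [this]
    apply Finset.card_le_card_of_surjOn (fun q => (R.erase q.1, insert q.2 X))
    rintro ⟨R', X'⟩ hq
    simp only [bipartiteBelow, mem_coe, mem_filter, mem_product, mem_powersetCard] at hq
    obtain ⟨⟨⟨⟨hR', hRc'⟩, hX', hXc'⟩, -⟩, h1, h2⟩ := hq
    have c1 : #(R \ R') = 1 := by rw [card_sdiff_of_subset h1]; omega
    have c2 : #(X' \ X) = 1 := by rw [card_sdiff_of_subset h2]; omega
    obtain ⟨k, hk⟩ := card_eq_one.1 c1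
    obtain ⟨j, hj⟩ := card_eq_one.1 c2
    have hk1 : k ∈ R \ R' := hk ▸ mem_singleton_self k
    have hj1 : j ∈ X' \ X := hj ▸ mem_singleton_self j
    rw [mem_sdiff] at hk1 hj1
    refine ⟨(k, j), ?_, ?_⟩
    · simp only [coe_product, Set.mem_prod, mem_coe, mem_sdiff]
      exact ⟨hk1.1, hX' hj1.1, hj1.2⟩
    · simp only [Prod.mk.injEq]
      constructor
      · rw [← sdiff_singleton_eq_erase, ← hk, Finset.sdiff_sdiff_eq_self h1]
      · rw [insert_eq, ← hj, sdiff_union_of_subset h2]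

lemma cross_step (I J : Finset ℕ) (g f : Finset ℕ → Finset ℕ → Prop) [∀ p : Finset ℕ × Finset ℕ, Decidable (g p.1 p.2)]
    [∀ p : Finset ℕ × Finset ℕ, Decidable (f p.1 p.2)]
    (hcross : ∀ R X Y, R ⊆ I → X ⊆ J → Y ⊆ J → g R X → f R Y → (X ∩ Y).Nonempty)
    (r x y : ℕ) :
    #{p ∈ powersetCard r I ×ˢ powersetCard x J | g p.1 p.2} * ((#J - x).choose y)
     ≤ #{p ∈ powersetCard r I ×ˢ powersetCard y J | ¬ f p.1 p.2} * ((#J - y).choose x) := by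
  classical
  apply Finset.card_mul_le_card_mul (fun p q => p.1 = q.1 ∧ p.2 ∩ q.2 = ∅)
  · rintro ⟨R, X⟩ hp
    simp only [mem_filter, mem_product, mem_powersetCard] at hp
    obtain ⟨⟨⟨hR, hRc⟩, hX, hXc⟩, hg⟩ := hp
    have : (#J - x).choose y = #(powersetCard y (J \ X)) := by
      rw [card_powersetCard, card_sdiff_of_subset hX, hXc]
    rw [this]
    apply Finset.card_le_card_of_injOn (fun q => (R, q))
    · intro Y hq
      simp only [mem_coe, mem_powersetCard] at hq
      have hd : X ∩ Y = ∅ := by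
        rw [← disjoint_iff_inter_eq_empty]
        exact (disjoint_of_subset_left hq.1 sdiff_disjoint).symm
      have hYJ := hq.1.trans sdiff_subset
      simp only [bipartiteAbove, mem_coe, mem_filter, mem_product, mem_powersetCard]
      refine ⟨⟨⟨⟨hR, hRc⟩, hYJ, hq.2⟩, fun hf => ?_⟩, trivial, hd⟩
      have := hcross R X Y hR hX hYJ hg hf
      rw [hd] at this
      simp at this
    · intro Y _ Y' _ h
      simpa using h
  · rintro ⟨R, Y⟩ hp
    simp only [mem_filter, mem_product, mem_powersetCard] at hp
    obtain ⟨⟨⟨hR, hRc⟩, hY, hYc⟩, hg⟩ := hp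
    have : (#J - y).choose x = #(powersetCard x (J \ Y)) := by
      rw [card_powersetCard, card_sdiff_of_subset hY, hYc]
    rw [this]
    apply Finset.card_le_card_of_surjOn (fun q => (R, q))
    rintro ⟨R', X'⟩ hq
    simp only [bipartiteBelow, mem_coe, mem_filter, mem_product, mem_powersetCard] at hq
    obtain ⟨⟨⟨⟨hR', hRc'⟩, hX', hXc'⟩, -⟩, h1, h2⟩ := hq
    refine ⟨X', ?_, by simp [h1]⟩
    simp only [mem_coe, mem_powersetCard]
    refine ⟨subset_sdiff.2 ⟨hX', disjoint_iff_inter_eq_empty.2 h2⟩, hXc'⟩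

lemma choose_swap (N x y : ℕ) : N.choose x * (N - x).choose y = N.choose y * (N - y).choose x := by
  have h1 := Nat.choose_mul (n := N) (k := x + y) (s := x) (by omega)
  have h2 := Nat.choose_mul (n := N) (k := x + y) (s := y) (by omega)
  rw [show x + y - x = y by omega] at h1
  rw [show x + y - y = x by omega] at h2
  rw [← h1, ← h2, Nat.choose_symm_add]

lemma core (I J : Finset ℕ) (g f : Finset ℕ → Finset ℕ → Prop) [∀ p : Finset ℕ × Finset ℕ, Decidable (g p.1 p.2)]
    [∀ p : Finset ℕ × Finset ℕ, Decidable (f p.1 p.2)]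
    (hcross : ∀ R X Y, R ⊆ I → X ⊆ J → Y ⊆ J → g R X → f R Y → (X ∩ Y).Nonempty)
    (hshift : ∀ R X j k, R ⊆ I → X ⊆ J → g R X → j ∈ X → k ∈ I → k ∉ R → g (insert k R) (X.erase j))
    (e d : ℕ) (hN : e + d ≤ #J) (hM : e ≤ #I)
    (hd : d = 0 → ∀ X, X ⊆ J → #X = e → ¬ g ∅ X) :
    ∑ r ∈ range e, (#{p ∈ powersetCard r I ×ˢ powersetCard (e - r) J | g p.1 p.2}
      + #{p ∈ powersetCard r I ×ˢ powersetCard (d + r) J | f p.1 p.2})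
    ≤ ∑ r ∈ range e, (#I).choose r * (#J).choose (d + r) := by
  classical
  set M := #I with hMdef
  set N := #J with hNdef
  set gc : ℕ → ℕ := fun r => #{p ∈ powersetCard r I ×ˢ powersetCard (e - r) J | g p.1 p.2} with hgc
  set fc : ℕ → ℕ := fun r => #{p ∈ powersetCard r I ×ˢ powersetCard (d + r) J | f p.1 p.2} with hfc
  have Tpos : ∀ r, r ≤ e → (0:ℚ) < M.choose r := fun r hr => by
    exact_mod_cast Nat.choose_pos (hr.trans hM)
  have Npos : ∀ r, (0:ℚ) < N.choose (e - r) := fun r => by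
    exact_mod_cast Nat.choose_pos (by omega)
  have step : ∀ r, r + 1 < e → (gc r : ℚ) / (M.choose r * N.choose (e - r)) ≤
      gc (r+1) / (M.choose (r+1) * N.choose (e - (r+1))) := by
    intro r hr
    have h := lym_step I J g hshift r (e - (r+1))
    rw [show e - (r+1) + 1 = e - r by omega] at h
    rw [← hMdef, ← hNdef] at h
    change gc r * _ ≤ gc (r+1) * _ at h
    have c1 := Nat.choose_succ_right_eq M r
    have c2 := Nat.choose_succ_right_eq N (e - (r+1))
    rw [show e - (r+1) + 1 = e - r by omega] at c2
    rw [div_le_div_iff₀ (mul_pos (Tpos _ (by omega)) (Npos _)) (mul_pos (Tpos _ (by omega)) (Npos _))]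
    have p1 : 0 < (M - r) * (N - (e - (r+1))) := Nat.mul_pos (by omega) (by omega)
    have p2 : 0 < (r+1) * (e - r) := Nat.mul_pos (by omega) (by omega)
    norm_cast
    refine Nat.le_of_mul_le_mul_right ?_ p2
    calc gc r * (M.choose (r + 1) * N.choose (e - (r + 1))) * ((r + 1) * (e - r))
        = gc r * (e - r) * (M.choose (r + 1) * (r+1)) * N.choose (e - (r + 1)) := by ring
      _ = (gc r * ((M - r) * (e - r))) * (M.choose r * N.choose (e - (r+1))) := by rw [c1]; ring
      _ ≤ (gc (r+1) * ((r + 1) * (N - (e - (r+1))))) * (M.choose r * N.choose (e - (r+1))) := 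
          Nat.mul_le_mul_right _ h
      _ = gc (r+1) * (r+1) * M.choose r * (N.choose (e - (r+1)) * (N - (e - (r+1)))) := by ring
      _ = _ := by rw [← c2]; ring
  have mono : ∀ r r', r ≤ r' → r' < e → (gc r : ℚ) / (M.choose r * N.choose (e - r)) ≤
      gc r' / (M.choose r' * N.choose (e - r')) := by
    intro r r' h
    induction r', h using Nat.le_induction with
    | base => intro _; exact le_rfl
    | succ q hq ih => intro h; exact (ih (by omega)).trans (step q h)
  have bound : ∀ r, r < e → (gc r : ℚ) / N.choose (e - r) * N.choose (d + r) + fc r ≤ 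
      M.choose r * N.choose (d+r) := by
    intro r hr
    have h := cross_step I J g f hcross r (e - r) (d + r)
    rw [← hNdef] at h
    change gc r * _ ≤ _ at h
    have hs := Finset.card_filter_add_card_filter_not (s := powersetCard r I ×ˢ powersetCard (d + r) J) (fun p => f p.1 p.2)
    rw [card_product, card_powersetCard, card_powersetCard] at hs
    change fc r + _ = _ at hs
    rw [← hNdef, ← hMdef] at hs
    set nf := #{p ∈ powersetCard r I ×ˢ powersetCard (d + r) J | ¬ f p.1 p.2}
    have hsw := choose_swap N (e - r) (d + r)
    have hpos : 0 < (N - (e - r)).choose (d + r) := Nat.choose_pos (by omega)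
    have h2 : gc r * N.choose (d+r) ≤ nf * N.choose (e-r) := by
      refine Nat.le_of_mul_le_mul_right ?_ hpos
      calc gc r * N.choose (d+r) * (N - (e - r)).choose (d + r) 
          = (gc r * (N - (e - r)).choose (d + r)) * N.choose (d+r) := by ring
        _ ≤ (nf * (N - (d + r)).choose (e - r)) * N.choose (d+r) := Nat.mul_le_mul_right _ h
        _ = nf * (N.choose (d+r) * (N - (d + r)).choose (e - r)) := by ring
        _ = _ := by rw [← hsw]; ring
    have h3 : (gc r : ℚ) / N.choose (e - r) * N.choose (d + r) ≤ nf := by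
      rw [div_mul_eq_mul_div, div_le_iff₀ (Npos r)]
      exact_mod_cast h2
    have h4 : (fc r : ℚ) + nf = M.choose r * N.choose (d+r) := by exact_mod_cast hs
    linarith
  have W := weighted N e d hN (fun r => if r < e then (gc r : ℚ) / N.choose (e - r) else 0)
    (fun r => by positivity) (by simp) ?_ ?_
  · have W' : ∑ r ∈ range e, ((gc r : ℚ) - (gc r : ℚ) / N.choose (e - r) * N.choose (d + r)) ≤ 0 := by
      refine le_of_eq_of_le ?_ W
      apply sum_congr rfl
      intro r hr
      rw [mem_range] at hr
      simp only [hr, if_true]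
      rw [mul_sub, div_mul_cancel₀ _ (Npos r).ne']
    have B : ∑ r ∈ range e, ((gc r : ℚ) / N.choose (e - r) * N.choose (d + r) + fc r) ≤ 
      ∑ r ∈ range e, ((M.choose r : ℚ) * N.choose (d+r)) := 
      sum_le_sum (fun r hr => bound r (mem_range.1 hr))
    have C : ∑ r ∈ range e, ((gc r : ℚ) + fc r) ≤ ∑ r ∈ range e, ((M.choose r : ℚ) * N.choose (d+r)) := by
      rw [sum_add_distrib] at B ⊢
      rw [sum_sub_distrib] at W'
      linarith
    exact_mod_cast C
  · intro h
    have : gc 0 = 0 := by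
      simp only [hgc, card_eq_zero, filter_eq_empty_iff]
      rintro ⟨R, X⟩ hp
      simp only [mem_product, mem_powersetCard, card_eq_zero, Nat.sub_zero] at hp
      obtain ⟨⟨-, rfl⟩, hX, hXc⟩ := hp
      exact hd h X hX hXc
    simp [this]
  · intro r r' h h' h''
    simp only [h', lt_of_le_of_lt h h', if_true]
    have m := mono r r' h h'
    have t1 := Tpos r (by omega)
    have t2 := Tpos r' (by omega)
    have T : (M.choose r : ℚ) ≤ M.choose r' := by
      exact_mod_cast choose_mono_sym h (by omega)
    have e1 : ∀ q, q < e → (gc q : ℚ) / N.choose (e - q) = (gc q : ℚ) / (M.choose q * N.choose (e - q)) * M.choose q := by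
      intro q hq
      have := Tpos q (by omega)
      have := Npos q
      field_simp
    rw [e1 r (by omega), e1 r' h']
    exact mul_le_mul m T t1.le (by positivity)

lemma batch (n : ℕ) (G : Finset (Finset ℕ)) (h : initialFam n G) (X : Finset ℕ) :
    ∀ (Y B : Finset ℕ), B ∈ G → X ⊆ B → Y ⊆ Icc 1 n → Disjoint Y B → #X = #Y →
      (∀ y ∈ Y, ∀ x ∈ X, y < x) → (B \ X) ∪ Y ∈ G := by
  induction X using Finset.induction_on with
  | empty =>
    intro Y B hB _ _ _ hc _
    have : Y = ∅ := by rw [← card_eq_zero, ← hc]; rfl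
    simpa [this] using hB
  | insert x X hx ih =>
    intro Y B hB hXB hY hd hc hlt
    rw [card_insert_of_notMem hx] at hc
    have hne : Y.Nonempty := by rw [← card_pos]; omega
    obtain ⟨y, hy⟩ := hne
    have hyB : y ∉ B := fun hh => (Finset.disjoint_left.1 hd hy) hh
    have hyx := hlt y hy x (mem_insert_self _ _)
    have h1 := h B hB y (hY hy) x (hXB (mem_insert_self _ _)) hyx hyB
    have h2 := ih (Y.erase y) _ h1 ?_ ((erase_subset _ _).trans hY) ?_ ?_ ?_
    · convert h2 using 1
      ext z
      simp only [mem_union, mem_sdiff, mem_insert, mem_erase]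
      have hyX : y ∉ X := fun hh => hyB (hXB (mem_insert_of_mem hh))
      by_cases hzy : z = y
      · subst hzy; simp [hy, hyX]
      · simp only [hzy]; tauto
    · intro z hz
      have hzB := hXB (mem_insert_of_mem hz)
      have : z ≠ x := fun hh => hx (hh ▸ hz)
      simp [this, hzB]
    · rw [Finset.disjoint_left]
      intro z hz hz'
      simp only [mem_erase, mem_insert] at hz hz'
      exact (Finset.disjoint_left.1 hd hz.2) (by tauto)
    · rw [card_erase_of_mem hy]; omega
    · intro y' hy' x' hx'
      exact hlt y' (mem_of_mem_erase hy') x' (mem_insert_of_mem hx')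

lemma seg (n b k : ℕ) (G : Finset (Finset ℕ)) (h : initialFam n G) (B : Finset ℕ) (hB : B ∈ G)
    (hBn : B ⊆ Icc 1 n) (hBc : #B = b) (hk : k ≤ n) (hd : ∀ x ∈ B, k < x) :
    Icc (k+1) (k+b) ∈ G := by
  have hkb : k + b ≤ n := by
    have : B ⊆ Icc (k+1) n := fun x hx => by
      have := hBn hx; have := hd x hx
      simp only [mem_Icc] at *; omega
    have := card_le_card this
    rw [Nat.card_Icc] at this
    omega
  have := batch n G h (B \ Icc (k+1) (k+b)) (Icc (k+1) (k+b) \ B) B hB sdiff_subset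
    (fun x hx => by simp only [mem_sdiff, mem_Icc] at *; omega) sdiff_disjoint
    (card_sdiff_comm (by rw [Nat.card_Icc]; omega))
    (fun y hy x hx => by
      simp only [mem_sdiff, mem_Icc] at hx hy
      have := hd x hx.1
      omega)
  convert this using 1
  ext z
  simp only [mem_union, mem_sdiff]
  tauto

lemma avoid (n k : ℕ) (G : Finset (Finset ℕ)) (h : initialFam n G) (B : Finset ℕ) (hB : B ∈ G)
    (hk : k ≤ n) (hd : ∀ x ∈ B, k < x) (S : Finset ℕ) (hS : #S ≤ k) :
    ∃ B' ∈ G, Disjoint B' S ∧ B' ⊆ B ∪ Icc 1 k := by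
  have h1 : #(B ∩ S) ≤ #(Icc 1 k \ S) := by
    have a1 : #(B ∩ S) + #(Icc 1 k ∩ S) ≤ #S := by
      rw [← card_union_of_disjoint]
      · exact card_le_card (union_subset inter_subset_right inter_subset_right)
      · rw [Finset.disjoint_left]
        intro z hz hz'
        simp only [mem_inter, mem_Icc] at hz hz'
        have := hd z hz.1
        omega
    have a2 := card_sdiff_add_card_inter (Icc 1 k) S
    rw [Nat.card_Icc] at a2
    omega
  obtain ⟨Y, hY, hYc⟩ := exists_subset_card_eq h1
  have hYk : ∀ y ∈ Y, 1 ≤ y ∧ y ≤ k ∧ y ∉ S := fun y hy => by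
    have := hY hy
    simp only [mem_sdiff, mem_Icc] at this
    tauto
  refine ⟨_, batch n G h (B ∩ S) Y B hB inter_subset_left ?_ ?_ hYc.symm ?_, ?_, ?_⟩
  · intro y hy
    have := hYk y hy
    rw [mem_Icc]; omega
  · rw [Finset.disjoint_left]
    intro z hz hz'
    have := hYk z hz
    have := hd z hz'
    omega
  · intro y hy x hx
    have := hYk y hy
    have := hd x (mem_inter.1 hx).1
    omega
  · rw [Finset.disjoint_left]
    intro z hz hz'
    simp only [mem_union, mem_sdiff, mem_inter] at hz
    rcases hz with hz | hz
    · tauto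
    · exact (hYk z hz).2.2 hz'
  · intro z hz
    simp only [mem_union, mem_sdiff, mem_inter] at hz
    rcases hz with hz | hz
    · exact mem_union_left _ hz.1
    · have := hYk z hz
      exact mem_union_right _ (mem_Icc.2 ⟨this.1, this.2.1⟩)

lemma classBound (n a b i t : ℕ) (hi : 1 ≤ i) (hib : i ≤ b)
    (ht : 2 ≤ t) (habt : b + t ≤ a + 1) (hnab : a + b ≤ n)
    (F G : Finset (Finset ℕ))
    (hGinit : initialFam n G)
    (hcross : crossInt F G)
    (hne : ∀ B ∈ G, ∃ x ∈ B, x ≤ a) :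
    ∑ r ∈ range (b + 1 - i), 
      (#{p ∈ powersetCard r (Icc (i+1) (b+t-1)) ×ˢ powersetCard (b + 1 - i - r) (Icc (b+t) n) | 
          Ico 1 i ∪ p.1 ∪ p.2 ∈ G}
      + #{p ∈ powersetCard r (Icc (i+1) (b+t-1)) ×ˢ powersetCard (a + i - b - t + r) (Icc (b+t) n) | 
          insert i ((Icc (i+1) (b+t-1) \ p.1) ∪ p.2) ∈ F})
    ≤ ∑ r ∈ range (b + 1 - i), (b+t-1-i).choose r * (n - b - t + 1).choose (a + i - b - t + r) := by
  have h := core (Icc (i+1) (b+t-1)) (Icc (b+t) n) (fun R X => Ico 1 i ∪ R ∪ X ∈ G)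
    (fun R Y => insert i ((Icc (i+1) (b+t-1) \ R) ∪ Y) ∈ F) ?_ ?_ (b+1-i) (a+i-b-t) ?_ ?_ ?_
  · rw [Nat.card_Icc, Nat.card_Icc] at h
    rw [show b + t - 1 + 1 - (i + 1) = b + t - 1 - i by omega,
      show n + 1 - (b + t) = n - b - t + 1 by omega] at h
    exact h
  · intro R X Y hR hX hY hg hf
    obtain ⟨z, hz⟩ := hcross _ hf _ hg
    have hR' := @hR z
    have hX' := @hX z
    have hY' := @hY z
    refine ⟨z, ?_⟩
    simp only [mem_inter, mem_insert, mem_union, mem_sdiff, mem_Icc, mem_Ico] at *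
    by_cases h1 : z ∈ R <;> by_cases h2 : z ∈ X <;> by_cases h3 : z ∈ Y <;> simp only [h1, h2, h3] at * <;> simp at * <;> omega
  · intro R X j k hR hX hg hj hk hkR
    have hjJ := hX hj
    rw [mem_Icc] at hjJ hk
    have hkX : k ∉ X := fun hh => by
      have := hX hh
      rw [mem_Icc] at this; omega
    have hjR : j ∉ R := fun hh => by
      have := hR hh
      rw [mem_Icc] at this; omega
    have := hGinit _ hg k (by rw [mem_Icc]; omega) j (by simp [hj]) (by omega) (by simp [hkR, hkX]; omega)
    convert this using 1
    ext z
    simp only [mem_union, mem_insert, mem_erase, mem_Ico]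
    by_cases hzj : z = j
    · subst hzj; simp [hjR]; omega
    · tauto
  · rw [Nat.card_Icc]; omega
  · rw [Nat.card_Icc]; omega
  · intro hd X hX hXc hg
    obtain ⟨x, hx, hxa⟩ := hne _ hg
    have hX' := @hX x
    simp only [mem_union, mem_Ico] at hx
    rw [mem_Icc] at hX'
    rcases hx with (hx | hx) | hx
    · omega
    · simp at hx
    · have := hX' hx; omega

lemma coverF (n s : ℕ) (hs : 1 ≤ s) (F : Finset (Finset ℕ)) (hFn : ∀ A ∈ F, A ⊆ Icc 1 n)
    (hFinit : initialFam n F) (hFcov : coverEQ n s F) : ∀ A ∈ F, ∃ i ∈ A, i ≤ s := by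
  intro A hA
  by_contra! hcon
  obtain ⟨-, T, hT, hTA, hTc⟩ := hFcov
  have hsn : s ≤ n := by
    have := card_le_card hT
    rw [Nat.card_Icc] at this; omega
  obtain ⟨A', hA', hd, -⟩ := avoid n s F hFinit A hA hsn hcon T hTc.le
  obtain ⟨z, hz⟩ := hTA A' hA'
  rw [mem_inter] at hz
  exact Finset.disjoint_left.1 hd hz.2 hz.1

lemma traceF (n b t : ℕ) (ht : 2 ≤ t) (hbt : b + t ≤ n) (F G : Finset (Finset ℕ))
    (hG : G ⊆ (Finset.Icc 1 n).powersetCard b)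
    (hGinit : initialFam n G) (hcross : crossInt F G) (hGcov : coverGE n t G) :
    ∀ A ∈ F, t ≤ #(A ∩ Icc 1 (b+t-1)) := by
  intro A hA
  by_contra! hcon
  obtain ⟨B0, hB0, hB0d⟩ : ∃ B0 ∈ G, ∀ x ∈ B0, t - 1 < x := by
    by_contra! hh
    have := hGcov (Icc 1 (t-1)) (Icc_subset_Icc le_rfl (by omega)) (fun B hB => by
      obtain ⟨x, hx, hxt⟩ := hh B hB
      have := (mem_powersetCard.1 (hG hB)).1 hx
      rw [mem_Icc] at this
      exact ⟨x, mem_inter.2 ⟨mem_Icc.2 ⟨this.1, hxt⟩, hx⟩⟩)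
    rw [Nat.card_Icc] at this
    omega
  have hB := mem_powersetCard.1 (hG hB0)
  have h1 := seg n b (t-1) G hGinit B0 hB0 hB.1 hB.2 (by omega) hB0d
  obtain ⟨B', hB', hd, hsub⟩ := avoid n (t-1) G hGinit _ h1 (by omega)
    (fun x hx => by rw [mem_Icc] at hx; omega) (A ∩ Icc 1 (b+t-1)) (by omega)
  obtain ⟨z, hz⟩ := hcross A hA B' hB'
  rw [mem_inter] at hz
  have h2 := hsub hz.2
  simp only [mem_union, mem_Icc] at h2
  exact Finset.disjoint_left.1 hd hz.2 (mem_inter.2 ⟨hz.1, mem_Icc.2 (by omega)⟩)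

lemma cardF (n a b s t : ℕ) (hsb : s ≤ b) (ht : 2 ≤ t) (habt : b + t ≤ a + 1) (hnab : a + b ≤ n)
    (F : Finset (Finset ℕ)) (hF : F ⊆ (Finset.Icc 1 n).powersetCard a)
    (h1 : ∀ A ∈ F, ∃ i ∈ A, i ≤ s) (h2 : ∀ A ∈ F, t ≤ #(A ∩ Icc 1 (b+t-1))) :
    #F ≤ ∑ i ∈ Icc 1 s, ∑ r ∈ range (b+1-i),
      #{p ∈ powersetCard r (Icc (i+1) (b+t-1)) ×ˢ powersetCard (a + i - b - t + r) (Icc (b+t) n) | 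
          insert i ((Icc (i+1) (b+t-1) \ p.1) ∪ p.2) ∈ F} := by
  have hsub : F ⊆ (Icc 1 s).biUnion (fun i => (range (b+1-i)).biUnion (fun r =>
      image (fun p : Finset ℕ × Finset ℕ => insert i ((Icc (i+1) (b+t-1) \ p.1) ∪ p.2))
      {p ∈ powersetCard r (Icc (i+1) (b+t-1)) ×ˢ powersetCard (a + i - b - t + r) (Icc (b+t) n) | 
          insert i ((Icc (i+1) (b+t-1) \ p.1) ∪ p.2) ∈ F})) := by
    intro A hA
    obtain ⟨hAn, hAc⟩ := mem_powersetCard.1 (hF hA)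
    have hex := h1 A hA
    classical
    let i := Nat.find (p := fun i => i ∈ A) (by obtain ⟨i, hi, -⟩ := hex; exact ⟨i, hi⟩)
    have hiA : i ∈ A := Nat.find_spec (p := fun i => i ∈ A) _
    have hmin : ∀ j ∈ A, i ≤ j := fun j hj => Nat.find_min' (p := fun i => i ∈ A) _ hj
    have his : i ≤ s := by
      obtain ⟨j, hj, hjs⟩ := hex
      exact (hmin j hj).trans hjs
    have hi1 := mem_Icc.1 (hAn hiA)
    clear_value i
    set I := Icc (i+1) (b+t-1) with hI
    set J := Icc (b+t) n with hJ
    have hdec : A = insert i ((A ∩ I) ∪ (A ∩ J)) := by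
      ext z
      simp only [mem_insert, mem_union, mem_inter, hI, hJ, mem_Icc]
      constructor
      · intro hz
        have := hmin z hz
        have := mem_Icc.1 (hAn hz)
        by_cases z = i
        · tauto
        · right
          by_cases z ≤ b + t - 1
          · left; exact ⟨hz, by omega⟩
          · right; exact ⟨hz, by omega⟩
      · rintro (h | h | h)
        · rw [h]; exact hiA
        · exact h.1
        · exact h.1
    have hdec2 : A = insert i ((I \ (I \ A)) ∪ (A ∩ J)) := by
      rw [_root_.sdiff_sdiff_right_self, inf_eq_inter, inter_comm I A]; exact hdec
    have hcI : #(I \ A) + #(A ∩ I) = b + t - 1 - i := by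
      have := card_sdiff_add_card_inter I A
      rw [inter_comm I A] at this
      rw [this, hI, Nat.card_Icc]; omega
    have hcA : a = #(A ∩ I) + #(A ∩ J) + 1 := by
      rw [← hAc]
      conv_lhs => rw [hdec]
      rw [card_insert_of_notMem, card_union_of_disjoint]
      · rw [Finset.disjoint_left]
        intro z hz hz'
        simp only [mem_inter, hI, hJ, mem_Icc] at hz hz'
        omega
      · simp only [mem_union, mem_inter, hI, hJ, mem_Icc]
        omega
    have hct : t ≤ #(A ∩ I) + 1 := by
      have : A ∩ Icc 1 (b+t-1) ⊆ insert i (A ∩ I) := by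
        intro z hz
        simp only [mem_inter, mem_insert, hI, mem_Icc] at hz ⊢
        have := hmin z hz.1
        by_cases z = i
        · tauto
        · exact Or.inr ⟨hz.1, by omega⟩
      exact (h2 A hA).trans ((card_le_card this).trans (card_insert_le _ _))
    rw [mem_biUnion]
    refine ⟨i, mem_Icc.2 ⟨hi1.1, his⟩, ?_⟩
    rw [mem_biUnion]
    refine ⟨#(I \ A), mem_range.2 (by omega), ?_⟩
    rw [mem_image]
    refine ⟨(I \ A, A ∩ J), ?_, hdec2.symm⟩
    rw [mem_filter]
    refine ⟨?_, hdec2 ▸ hA⟩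
    rw [mem_product, mem_powersetCard, mem_powersetCard]
    exact ⟨⟨sdiff_subset, rfl⟩, inter_subset_right, by simp only; omega⟩
  refine (card_le_card hsub).trans (card_biUnion_le.trans (sum_le_sum fun i _ =>
    card_biUnion_le.trans (sum_le_sum fun r _ => card_image_le)))

lemma cardG (n b s t : ℕ) (hsb : s ≤ b) (ht : 2 ≤ t) 
    (G : Finset (Finset ℕ)) (hG : G ⊆ (Finset.Icc 1 n).powersetCard b) :
    #G ≤ (n-s).choose (b-s) + ∑ i ∈ Icc 1 s, (∑ r ∈ range (b+1-i),
      #{p ∈ powersetCard r (Icc (i+1) (b+t-1)) ×ˢ powersetCard (b + 1 - i - r) (Icc (b+t) n) | 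
          Ico 1 i ∪ p.1 ∪ p.2 ∈ G} + (b+t-1-i).choose (b+1-i)) := by
  have hsub : G ⊆ (image (fun X => Icc 1 s ∪ X) (powersetCard (b-s) (Icc (s+1) n))) ∪ 
      (Icc 1 s).biUnion (fun i => (range (b+1-i)).biUnion (fun r =>
      image (fun p : Finset ℕ × Finset ℕ => Ico 1 i ∪ p.1 ∪ p.2)
      {p ∈ powersetCard r (Icc (i+1) (b+t-1)) ×ˢ powersetCard (b + 1 - i - r) (Icc (b+t) n) | 
          Ico 1 i ∪ p.1 ∪ p.2 ∈ G}) ∪ image (fun X => Ico 1 i ∪ X) (powersetCard (b+1-i) (Icc (i+1) (b+t-1)))) := by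
    intro B hB
    obtain ⟨hBn, hBc⟩ := mem_powersetCard.1 (hG hB)
    rw [mem_union]
    by_cases hs : Icc 1 s ⊆ B
    · left
      rw [mem_image]
      refine ⟨B \ Icc 1 s, ?_, union_sdiff_of_subset hs⟩
      rw [mem_powersetCard, card_sdiff_of_subset hs, hBc, Nat.card_Icc]
      refine ⟨?_, by omega⟩
      intro z hz
      rw [mem_sdiff] at hz
      have := hBn hz.1
      simp only [mem_Icc] at *
      omega
    right
    have hex : ∃ i, 1 ≤ i ∧ i ≤ s ∧ i ∉ B := by
      obtain ⟨i, hi, hi'⟩ := not_subset.1 hs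
      rw [mem_Icc] at hi
      exact ⟨i, hi.1, hi.2, hi'⟩
    classical
    let i := Nat.find hex
    obtain ⟨hi1, his, hiB⟩ := Nat.find_spec hex
    have hmin : ∀ j, 1 ≤ j → j < i → j ∈ B := fun j hj hji => by
      have := Nat.find_min hex hji
      by_contra hjB
      exact this ⟨hj, by omega, hjB⟩
    change 1 ≤ i at hi1
    change i ≤ s at his
    change i ∉ B at hiB
    clear_value i
    set I := Icc (i+1) (b+t-1) with hI
    set J := Icc (b+t) n with hJ
    have hdec : B = Ico 1 i ∪ (B ∩ I) ∪ (B ∩ J) := by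
      ext z
      simp only [mem_union, mem_inter, hI, hJ, mem_Icc, mem_Ico]
      constructor
      · intro hz
        have := mem_Icc.1 (hBn hz)
        have : z ≠ i := fun h => hiB (h ▸ hz)
        by_cases z < i
        · left; left; omega
        by_cases z ≤ b + t - 1
        · left; right; exact ⟨hz, by omega⟩
        · right; exact ⟨hz, by omega⟩
      · rintro ((h | h) | h)
        · exact hmin z h.1 h.2
        · exact h.1
        · exact h.1
    have hcB : b = (i - 1) + #(B ∩ I) + #(B ∩ J) := by
      rw [← hBc]
      conv_lhs => rw [hdec]
      rw [card_union_of_disjoint, card_union_of_disjoint, Nat.card_Ico]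
      · rw [Finset.disjoint_left]
        intro z hz hz'
        simp only [mem_inter, hI, mem_Icc, mem_Ico] at hz hz'
        omega
      · rw [Finset.disjoint_left]
        intro z hz hz'
        simp only [mem_union, mem_inter, hI, hJ, mem_Icc, mem_Ico] at hz hz'
        omega
    rw [mem_biUnion]
    refine ⟨i, mem_Icc.2 ⟨hi1, his⟩, ?_⟩
    rw [mem_union]
    by_cases hr : #(B ∩ I) < b + 1 - i
    · left
      rw [mem_biUnion]
      refine ⟨#(B ∩ I), mem_range.2 hr, ?_⟩
      rw [mem_image]
      refine ⟨(B ∩ I, B ∩ J), ?_, hdec.symm⟩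
      rw [mem_filter]
      refine ⟨?_, hdec ▸ hB⟩
      rw [mem_product, mem_powersetCard, mem_powersetCard]
      exact ⟨⟨inter_subset_right, rfl⟩, inter_subset_right, by simp only; omega⟩
    · right
      rw [mem_image]
      have h0 : B ∩ J = ∅ := by rw [← card_eq_zero]; omega
      refine ⟨B ∩ I, ?_, ?_⟩
      · rw [mem_powersetCard]
        exact ⟨inter_subset_right, by omega⟩
      · rw [h0, union_empty] at hdec
        exact hdec.symm
  refine (card_le_card hsub).trans ((card_union_le _ _).trans (Nat.add_le_add ?_ ?_))
  · refine card_image_le.trans ?_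
    rw [card_powersetCard, Nat.card_Icc]
    rw [show n + 1 - (s + 1) = n - s by omega]
  · refine card_biUnion_le.trans (sum_le_sum fun i _ => (card_union_le _ _).trans (Nat.add_le_add ?_ ?_))
    · exact card_biUnion_le.trans (sum_le_sum fun r _ => card_image_le)
    · refine card_image_le.trans ?_
      rw [card_powersetCard, Nat.card_Icc]
      rw [show b + t - 1 + 1 - (i + 1) = b + t - 1 - i by omega]

lemma hockey (b m s : ℕ) (hsb : s ≤ b) (hbm : b ≤ m) :
    ∑ i ∈ Icc 1 s, (m-i).choose (b+1-i) + (m-s).choose (b-s) = m.choose b := by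
  induction s with
  | zero => simp
  | succ s ih =>
    rw [sum_Icc_succ_top (by omega), ← ih (by omega)]
    obtain ⟨b', hb'⟩ : ∃ b', b - s = b' + 1 := ⟨b - s - 1, by omega⟩
    obtain ⟨m', hm'⟩ : ∃ m', m - s = m' + 1 := ⟨m - s - 1, by omega⟩
    rw [hb', hm', Nat.choose_succ_succ, show m - (s+1) = m' by omega, show b + 1 - (s+1) = b' + 1 by omega,
      show b - (s+1) = b' by omega]
    ring

lemma vander (n a b i t : ℕ) (hi : 1 ≤ i) (hib : i ≤ b)
    (ht : 2 ≤ t) (habt : b + t ≤ a + 1) (hnab : a + b ≤ n) :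
    ∑ r ∈ range (b + 1 - i), (b+t-1-i).choose r * (n - b - t + 1).choose (a + i - b - t + r)
    + ∑ k ∈ range (t - i), (b+t-i-1).choose k * (n - b - t + 1).choose (a - k - 1)
    ≤ (n - i).choose (a - 1) := by
  set M := b+t-1-i with hM
  set N := n - b - t + 1 with hN
  rw [show b + t - i - 1 = M by omega, show n - i = M + N by omega, Nat.add_choose_eq,
    Nat.sum_antidiagonal_eq_sum_range_succ (fun x y => M.choose x * N.choose y)]
  have h1 : ∑ k ∈ range (t - i), M.choose k * N.choose (a - k - 1) ≤ 
      ∑ k ∈ range (t - 1), M.choose k * N.choose (a - 1 - k) := by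
    refine le_trans (le_of_eq (sum_congr rfl fun k _ => by rw [show a - k - 1 = a - 1 - k by omega])) 
      (sum_le_sum_of_subset (range_subset_range.2 (by omega)))
  have h2 : ∑ r ∈ range (b + 1 - i), M.choose r * N.choose (a + i - b - t + r) = 
      ∑ k ∈ range (b + 1 - i), M.choose (t - 1 + k) * N.choose (a - 1 - (t - 1 + k)) := by
    rw [← sum_range_reflect]
    apply sum_congr rfl
    intro k hk
    rw [mem_range] at hk
    rw [show a + i - b - t + (b + 1 - i - 1 - k) = a - 1 - (t - 1 + k) by omega,
      ← Nat.choose_symm (n := M) (k := t - 1 + k) (by omega), show M - (t - 1 + k) = b + 1 - i - 1 - k by omega]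
  rw [h2, add_comm]
  refine (Nat.add_le_add_right h1 _).trans ?_
  rw [← sum_range_add (fun k => M.choose k * N.choose (a - 1 - k))]
  exact sum_le_sum_of_subset (range_subset_range.2 (by omega))

theorem stmt8 (n a b s t : ℕ) (hn : 1 ≤ n) (ha : 1 ≤ a) (hb : 1 ≤ b) (hs : 1 ≤ s)
    (ht : 2 ≤ t) (habt : b + t ≤ a + 1) (hnab : a + b ≤ n)
    (F G : Finset (Finset ℕ))
    (hF : F ⊆ (Finset.Icc 1 n).powersetCard a)
    (hG : G ⊆ (Finset.Icc 1 n).powersetCard b)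
    (hFinit : initialFam n F)
    (hGinit : initialFam n G)
    (hcross : crossInt F G)
    (hFcov : coverEQ n s F)
    (hGcov : coverGE n t G) :
    (F.card : ℤ) + G.card ≤ HstSize n a b s t := by
  obtain ⟨B, hB⟩ : G.Nonempty := by
    rw [nonempty_iff_ne_empty]
    rintro rfl
    have := hGcov ∅ (by simp) (by simp)
    simp at this; omega
  obtain ⟨A, hA⟩ : F.Nonempty := by
    rw [nonempty_iff_ne_empty]
    rintro rfl
    have := hFcov.1 ∅ (by simp) (by simp)
    simp at this; omega
  have hBm := mem_powersetCard.1 (hG hB)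
  have hAm := mem_powersetCard.1 (hF hA)
  have hsb : s ≤ b := by
    rw [← hBm.2]
    refine hFcov.1 B hBm.1 (fun A' hA' => ?_)
    rw [inter_comm]
    exact hcross A' hA' B hB
  have hne : ∀ B ∈ G, ∃ x ∈ B, x ≤ a := by
    intro B' hB'
    have h := seg n a 0 F hFinit A hA hAm.1 hAm.2 (by omega)
      (fun x hx => by have := mem_Icc.1 (hAm.1 hx); omega)
    obtain ⟨z, hz⟩ := hcross _ h B' hB'
    rw [mem_inter, mem_Icc] at hz
    exact ⟨z, hz.2, by omega⟩
  have c1 := coverF n s hs F (fun A' hA' => (mem_powersetCard.1 (hF hA')).1) hFinit hFcov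
  have c2 := traceF n b t ht (by omega) F G hG hGinit hcross hGcov
  have cF := cardF n a b s t hsb ht habt hnab F hF c1 c2
  have cG := cardG n b s t hsb ht G hG
  have hk := hockey b (b+t-1) s hsb (by omega)
  have hcl : ∀ i ∈ Icc 1 s, _ := fun i hi => classBound n a b i t (mem_Icc.1 hi).1
    ((mem_Icc.1 hi).2.trans hsb) ht habt hnab F G hGinit hcross hne
  have hsum := sum_le_sum hcl
  simp only [sum_add_distrib] at hsum cG
  have hv : ∀ i ∈ Icc 1 s, _ := fun i hi => vander n a b i t (mem_Icc.1 hi).1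
    ((mem_Icc.1 hi).2.trans hsb) ht habt hnab
  have hvs := sum_le_sum hv
  simp only [sum_add_distrib] at hvs
  unfold HstSize
  rw [sum_sub_distrib]
  rw [show b + t - s - 1 = b + t - 1 - s by omega]
  have main : #F + #G + ∑ j ∈ Icc 1 s, ∑ k ∈ range (t - j), (b+t-j-1).choose k * (n - b - t + 1).choose (a - k - 1)
     + (b + t - 1 - s).choose (b - s) ≤ ∑ j ∈ Icc 1 s, (n - j).choose (a - 1) + (n-s).choose (b-s) + (b+t-1).choose b := by
    omega
  zify at main
  linarith
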